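/- Let C be a knot-like complex, and assume C is locally equivalent to the standard complex C(a_1,…,a_n). Then C is homotopy equivalent, as a bigraded chain complex over R, to the direct sum C(a_1,…,a_n) ⊕ A for some chain complex A over R. -/

import Mathlib

/-!
Common setup: the ring `R = 𝔽₂[U,V]/(UV = 0)`, bigraded free finitely generated chain
complexes over `R` ("pre-complexes"), knot-like complexes, local maps and local
equivalence, standard and semistandard complexes, short maps, the `Z^!` order,
the invariants `a_i`, `φ_j`, `P`, shift maps, tensor products, duals, and direct sums.
-/

set_option synthInstance.maxHeartbeats 1000000
set_option maxHeartbeats 1000000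

noncomputable section

/-- The polynomial ring `𝔽₂[U,V]`. -/
abbrev PolyUV : Type := MvPolynomial (Fin 2) (ZMod 2)

/-- The ideal `(U·V)`. -/
def IUV : Ideal PolyUV := Ideal.span {(MvPolynomial.X 0 * MvPolynomial.X 1 : PolyUV)}

/-- The ring `R = 𝔽₂[U,V]/(UV = 0)`. -/
abbrev RUV : Type := PolyUV ⧸ IUV

instance : CommRing RUV := Ideal.Quotient.commRing IUV

/-- The image of `U` in `R`. -/
def Uv : RUV := Ideal.Quotient.mk IUV (MvPolynomial.X 0)

/-- The image of `V` in `R`. -/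
def Vv : RUV := Ideal.Quotient.mk IUV (MvPolynomial.X 1)

/-- `r ∈ R` is homogeneous of bidegree `(p, q)` for the bigrading with
`gr(U) = (-2, 0)`, `gr(V) = (0, -2)`, `gr(1) = (0, 0)` (coefficients in `𝔽₂`). -/
def IsHomog (r : RUV) (p q : ℤ) : Prop :=
  r = 0 ∨ (∃ a : ℕ, r = Uv ^ a ∧ p = -(2 * (a : ℤ)) ∧ q = 0) ∨
    (∃ b : ℕ, r = Vv ^ b ∧ p = 0 ∧ q = -(2 * (b : ℤ)))

/-- A finitely generated free bigraded module over `R` with a distinguished basis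
indexed by `Fin n`, together with a bigrading `gr` on the basis and a matrix `dm`
recording a prospective differential: `dm i j` is the coefficient of the `j`-th basis
vector in the differential of the `i`-th basis vector. -/
structure PreCx where
  n : ℕ
  gr : Fin n → ℤ × ℤ
  dm : Fin n → Fin n → RUV

/-- The underlying free `R`-module of a pre-complex. -/
abbrev Msub (C : PreCx) : Type := Fin C.n →₀ RUV

/-- The differential of a pre-complex, as an `R`-linear map. -/
def dmap (C : PreCx) : Msub C →ₗ[RUV] Msub C :=
  Finsupp.linearCombination RUV fun i => ∑ j, Finsupp.single j (C.dm i j)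

/-- The submodule `U·C ⊆ C`; `C/U` is the quotient by this submodule. -/
def uSub (C : PreCx) : Submodule RUV (Msub C) :=
  LinearMap.range (LinearMap.lsmul RUV (Msub C) Uv)

/-- The submodule `V·C ⊆ C`; `C/V` is the quotient by this submodule. -/
def vSub (C : PreCx) : Submodule RUV (Msub C) :=
  LinearMap.range (LinearMap.lsmul RUV (Msub C) Vv)

/-- Chains which die in the homology of `C/U`: the preimage in `C` of the boundaries of
the induced differential on `C/U`. -/
def bdryU (C : PreCx) : Submodule RUV (Msub C) := uSub C ⊔ LinearMap.range (dmap C)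

/-- Chains which die in the homology of `C/V`. -/
def bdryV (C : PreCx) : Submodule RUV (Msub C) := vSub C ⊔ LinearMap.range (dmap C)

/-- A chain `x ∈ C` is homogeneous of bidegree `(p, q)`. -/
def ChainHomog (C : PreCx) (x : Msub C) (p q : ℤ) : Prop :=
  ∀ j, IsHomog (x j) (p - (C.gr j).1) (q - (C.gr j).2)

/-- `x` is a `V`-tower class generator: its class in `H_*(C/U)` is a `V`-nontorsion cycle
whose image generates `H_*(C/U)/(V-torsion)` (equivalently, it is maximally `V`-graded
among `V`-nontorsion classes). -/
def IsVTowerGen (C : PreCx) (x : Msub C) : Prop :=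
  dmap C x ∈ uSub C ∧ (∀ k : ℕ, Vv ^ k • x ∉ bdryU C) ∧
    ∀ z : Msub C, dmap C z ∈ uSub C →
      ∃ (r : RUV) (k : ℕ), Vv ^ k • (z - r • x) ∈ bdryU C

/-- `x` is a `U`-tower class generator: its class in `H_*(C/V)` is a `U`-nontorsion cycle
whose image generates `H_*(C/V)/(U-torsion)`. -/
def IsUTowerGen (C : PreCx) (x : Msub C) : Prop :=
  dmap C x ∈ vSub C ∧ (∀ k : ℕ, Uv ^ k • x ∉ bdryV C) ∧
    ∀ z : Msub C, dmap C z ∈ vSub C →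
      ∃ (r : RUV) (k : ℕ), Uv ^ k • (z - r • x) ∈ bdryV C

/-- `C` is a chain complex over `R` whose differential has degree `(-1, -1)`. -/
def IsCplx (C : PreCx) : Prop :=
  (∀ x, dmap C (dmap C x) = 0) ∧
    ∀ i j, IsHomog (C.dm i j) ((C.gr i).1 - 1 - (C.gr j).1) ((C.gr i).2 - 1 - (C.gr j).2)

/-- A knot-like complex: a free, finitely generated, bigraded chain complex over `R`
whose differential has degree `(-1,-1)`, such that `H_*(C/U)/(V`-torsion`) ≅ 𝔽₂[V]` with
all `V`-nontorsion elements of `H_*(C/U)` in `U`-grading `0`, and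
`H_*(C/V)/(U`-torsion`) ≅ 𝔽₂[U]` with all `U`-nontorsion elements of `H_*(C/V)` in
`V`-grading `0`. -/
structure IsKnotLike (C : PreCx) : Prop where
  dsq : ∀ x, dmap C (dmap C x) = 0
  dhomog : ∀ i j, IsHomog (C.dm i j)
    ((C.gr i).1 - 1 - (C.gr j).1) ((C.gr i).2 - 1 - (C.gr j).2)
  vTowerExists : ∃ x, IsVTowerGen C x
  vTowerGr : ∀ x p q, ChainHomog C x p q → dmap C x ∈ uSub C →
    (∀ k : ℕ, Vv ^ k • x ∉ bdryU C) → p = 0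
  uTowerExists : ∃ x, IsUTowerGen C x
  uTowerGr : ∀ x p q, ChainHomog C x p q → dmap C x ∈ vSub C →
    (∀ k : ℕ, Uv ^ k • x ∉ bdryV C) → q = 0

/-- A module map `f : C₁ → C₂` is homogeneous of bidegree `(s, t)`. -/
def MapHomogShift (C₁ C₂ : PreCx) (f : Msub C₁ →ₗ[RUV] Msub C₂) (s t : ℤ) : Prop :=
  ∀ i j, IsHomog (f (Finsupp.single i 1) j)
    ((C₁.gr i).1 + s - (C₂.gr j).1) ((C₁.gr i).2 + t - (C₂.gr j).2)

/-- A local map `f : C₁ → C₂`: an absolutely `U`-graded, relatively `V`-graded,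
`R`-equivariant chain map inducing an isomorphism on `H_*(·/U)/(V-torsion)`
(equivalently, taking `V`-tower generators to `V`-tower generators). -/
structure IsLocalMap (C₁ C₂ : PreCx) (f : Msub C₁ →ₗ[RUV] Msub C₂) : Prop where
  chain : ∀ x, f (dmap C₁ x) = dmap C₂ (f x)
  graded : ∃ s : ℤ, MapHomogShift C₁ C₂ f 0 s
  towers : ∀ x, IsVTowerGen C₁ x → IsVTowerGen C₂ (f x)

/-- `C₁ ≤ C₂`: there exists a local map `C₁ → C₂`. -/
def LocalLE (C₁ C₂ : PreCx) : Prop := ∃ f, IsLocalMap C₁ C₂ f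

/-- Local equivalence of complexes: local maps in both directions. -/
def LocalEquiv (C₁ C₂ : PreCx) : Prop := LocalLE C₁ C₂ ∧ LocalLE C₂ C₁

/-- `C` is reduced: `∂ ≡ 0 mod (U, V)`. -/
def Reduced (C : PreCx) : Prop := ∀ i j, C.dm i j ∈ Ideal.span ({Uv, Vv} : Set RUV)

/-! ### Standard complexes -/

/-- The shift in bigrading from `x_k` to `x_{k+1}` in a standard complex, where the
parameter joining them is `b` (`k` is the 0-based index of the parameter, so the
parameter is a `U`-power arrow if `k` is even and a `V`-power arrow if `k` is odd). -/
def stepShift (k : ℕ) (b : ℤ) : ℤ × ℤ :=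
  if k % 2 = 0 then
    if b < 0 then (2 * (b.natAbs : ℤ) - 1, -1) else (1 - 2 * (b.natAbs : ℤ), 1)
  else
    if b < 0 then (-1, 2 * (b.natAbs : ℤ) - 1) else (1, 1 - 2 * (b.natAbs : ℤ))

/-- Bigrading of `x_i` relative to `x_0` in the standard complex with parameters `L`. -/
def grRel (L : List ℤ) (i : ℕ) : ℤ × ℤ :=
  ∑ k ∈ Finset.range i, stepShift k (L.getD k 0)

/-- The bigrading of the standard complex of parameters `L`, normalized so that
`gr_U(x_0) = 0` and `gr_V(x_n) = 0`. -/
def stdGr (L : List ℤ) (i : Fin (L.length + 1)) : ℤ × ℤ :=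
  ((grRel L (i : ℕ)).1, (grRel L (i : ℕ)).2 - (grRel L L.length).2)

/-- The differential matrix of the standard complex of parameters `L = (b_1, …, b_n)`:
for `i` odd (1-based), `∂_U x_{i-1} = U^{|b_i|} x_i` if `b_i < 0` and
`∂_U x_i = U^{b_i} x_{i-1}` if `b_i > 0`; for `i` even the same with `V` in place of `U`;
all other differentials vanish. -/
def stdDm (L : List ℤ) (i j : Fin (L.length + 1)) : RUV :=
  if (j : ℕ) = (i : ℕ) + 1 ∧ L.getD (i : ℕ) 0 < 0 then
    (if (i : ℕ) % 2 = 0 then Uv else Vv) ^ (L.getD (i : ℕ) 0).natAbs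
  else if (i : ℕ) = (j : ℕ) + 1 ∧ 0 < L.getD (j : ℕ) 0 then
    (if (j : ℕ) % 2 = 0 then Uv else Vv) ^ (L.getD (j : ℕ) 0).natAbs
  else 0

/-- The standard complex `C(b_1, …, b_n)` of a list of parameters `L = (b_1, …, b_n)`,
with generators `x_0, …, x_n`.  (For `L = []` this is the trivial complex `R`.) -/
def StdCx (L : List ℤ) : PreCx := ⟨L.length + 1, stdGr L, stdDm L⟩

/-- `L` is a valid parameter sequence for a standard complex: all entries are nonzero
and the length is even (possibly zero). -/
def IsStdSeq (L : List ℤ) : Prop := (∀ b ∈ L, b ≠ 0) ∧ Even L.length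

/-- The trivial standard complex `C(0) = R`. -/
def trivCx : PreCx := StdCx []

/-- The bigrading of the semistandard complex `C'(b_1, …, b_n)` (`n` odd), inherited from
the ambient standard complex `C(b_1, …, b_n, 1)`. -/
def semiGr (L : List ℤ) (i : Fin (L.length + 1)) : ℤ × ℤ :=
  ((grRel L (i : ℕ)).1, (grRel L (i : ℕ)).2 - (grRel L L.length).2 + 1)

/-- The semistandard complex `C'(b_1, …, b_n)` (`n` odd): the subcomplex of
`C(b_1, …, b_n, 1)` generated by `x_0, …, x_n`. -/
def SemiStdCx (L : List ℤ) : PreCx := ⟨L.length + 1, semiGr L, stdDm L⟩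

/-! ### Tensor products, duals, direct sums -/

/-- The tensor product (over `R`) of two pre-complexes, with basis `x_i ⊗ y_j` and
differential `∂(x ⊗ y) = ∂x ⊗ y + x ⊗ ∂y` (signs are irrelevant in characteristic 2). -/
def tensorCx (C₁ C₂ : PreCx) : PreCx where
  n := C₁.n * C₂.n
  gr := fun p => C₁.gr (finProdFinEquiv.symm p).1 + C₂.gr (finProdFinEquiv.symm p).2
  dm := fun p q =>
    (if (finProdFinEquiv.symm p).2 = (finProdFinEquiv.symm q).2 then
      C₁.dm (finProdFinEquiv.symm p).1 (finProdFinEquiv.symm q).1 else 0) +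
    (if (finProdFinEquiv.symm p).1 = (finProdFinEquiv.symm q).1 then
      C₂.dm (finProdFinEquiv.symm p).2 (finProdFinEquiv.symm q).2 else 0)

/-- The dual complex `C^∨ = Hom_R(C, R)`, described on the dual basis: the gradings are
negated and the differential matrix is transposed. -/
def dualCx (C : PreCx) : PreCx := ⟨C.n, fun i => -C.gr i, fun i j => C.dm j i⟩

/-- The direct sum of two pre-complexes. -/
def sumCx (C₁ C₂ : PreCx) : PreCx where
  n := C₁.n + C₂.n
  gr := fun p => Sum.elim C₁.gr C₂.gr (finSumFinEquiv.symm p)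
  dm := fun p q =>
    match finSumFinEquiv.symm p, finSumFinEquiv.symm q with
    | Sum.inl i, Sum.inl k => C₁.dm i k
    | Sum.inr j, Sum.inr l => C₂.dm j l
    | _, _ => 0

/-- A homotopy equivalence of bigraded chain complexes over `R`: chain maps `f, g`
preserving the bigrading, with `g ∘ f ≃ id` and `f ∘ g ≃ id` via `R`-equivariant
homotopies of bidegree `(1, 1)`. -/
def HomotopyEquivCx (C₁ C₂ : PreCx) : Prop :=
  ∃ (f : Msub C₁ →ₗ[RUV] Msub C₂) (g : Msub C₂ →ₗ[RUV] Msub C₁)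
    (H : Msub C₁ →ₗ[RUV] Msub C₁) (K : Msub C₂ →ₗ[RUV] Msub C₂),
    (∀ x, f (dmap C₁ x) = dmap C₂ (f x)) ∧
    (∀ y, g (dmap C₂ y) = dmap C₁ (g y)) ∧
    MapHomogShift C₁ C₂ f 0 0 ∧ MapHomogShift C₂ C₁ g 0 0 ∧
    MapHomogShift C₁ C₁ H 1 1 ∧ MapHomogShift C₂ C₂ K 1 1 ∧
    (∀ x, g (f x) - x = dmap C₁ (H x) + H (dmap C₁ x)) ∧
    (∀ y, f (g y) - y = dmap C₂ (K y) + K (dmap C₂ y))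

/-- An isomorphism of bigraded chain complexes over `R`. -/
def IsBigradedChainIso (C₁ C₂ : PreCx) (f : Msub C₁ →ₗ[RUV] Msub C₂) : Prop :=
  Function.Bijective f ∧ (∀ x, f (dmap C₁ x) = dmap C₂ (f x)) ∧ MapHomogShift C₁ C₂ f 0 0

/-! ### Short maps -/

/-- A short map `f : C(b_1, …, b_n) ⇝ C`: an absolutely `U`-graded, relatively
`V`-graded `R`-module map which is a chain map at `x_1, …, x_{n-1}` and commutes with
the `V`-part of the differential at `x_n` (for reduced `C`, the failure
`∂ f(x_n) - f(∂_V x_n)` is exactly `∂_U f(x_n) ∈ U·C`). -/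
def IsShortMap (L : List ℤ) (C : PreCx) (f : Msub (StdCx L) →ₗ[RUV] Msub C) : Prop :=
  (∃ s : ℤ, MapHomogShift (StdCx L) C f 0 s) ∧
  (∀ i : Fin (L.length + 1), 1 ≤ (i : ℕ) → (i : ℕ) + 1 ≤ L.length →
    f (dmap (StdCx L) (Finsupp.single i 1)) = dmap C (f (Finsupp.single i 1))) ∧
  dmap C (f (Finsupp.single (Fin.last L.length) 1)) -
    f (dmap (StdCx L) (Finsupp.single (Fin.last L.length) 1)) ∈ uSub C

/-- A short local map: a short map sending the `V`-tower generator `x_0` to a `V`-tower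
generator (hence inducing an isomorphism on `H_*(·/U)/(V-torsion)`). -/
def IsShortLocalMap (L : List ℤ) (C : PreCx) (f : Msub (StdCx L) →ₗ[RUV] Msub C) : Prop :=
  IsShortMap L C f ∧ IsVTowerGen C (f (Finsupp.single (0 : Fin (L.length + 1)) 1))

/-- A local map from the semistandard complex `C'(b_1, …, b_n)` to a knot-like complex:
a grading-preserving `R`-equivariant chain map under which the class of `x_0`
generates `H_*(C/U)/(V-torsion)`. -/
def IsSemiLocalMap (L : List ℤ) (C : PreCx) (f : Msub (SemiStdCx L) →ₗ[RUV] Msub C) : Prop :=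
  (∀ x, f (dmap (SemiStdCx L) x) = dmap C (f x)) ∧
  MapHomogShift (SemiStdCx L) C f 0 0 ∧
  IsVTowerGen C (f (Finsupp.single (0 : Fin (L.length + 1)) 1))

/-! ### The order `Z^!` and the numerical invariants -/

/-- The embedding of `Z^!` into `ℚ` realizing the order
`-1 <^! -2 <^! ⋯ <^! 0 <^! ⋯ <^! 2 <^! 1`: send `0 ↦ 0` and `a ↦ 1/a` otherwise. -/
def qval (a : ℤ) : ℚ := if a = 0 then 0 else 1 / (a : ℚ)

/-- The order `≤^!` on `Z^!`. -/
def bangLE (a b : ℤ) : Prop := qval a ≤ qval b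

/-- Pad a finite sequence with trailing zeros. -/
def seqPad (L : List ℤ) (i : ℕ) : ℤ := L.getD i 0

/-- The lexicographic order on finite integer sequences induced by `≤^!`, padding the
shorter sequence with trailing zeros. -/
def bangLexLE (L₁ L₂ : List ℤ) : Prop :=
  (∀ i, seqPad L₁ i = seqPad L₂ i) ∨
    ∃ k, (∀ i < k, seqPad L₁ i = seqPad L₂ i) ∧ qval (seqPad L₁ k) < qval (seqPad L₂ k)

/-- `m` is an upper bound for `S ⊆ Z^!` with respect to `≤^!`. -/
def IsBangUB (S : Set ℤ) (m : ℤ) : Prop := ∀ b ∈ S, qval b ≤ qval m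

/-- `m = sup^! S`, the least upper bound of `S ⊆ Z^!` with respect to `≤^!`. -/
def IsBangLUB (S : Set ℤ) (m : ℤ) : Prop :=
  IsBangUB S m ∧ ∀ m' : ℤ, IsBangUB S m' → qval m ≤ qval m'

/-- Candidate set for the next invariant: given the already-constructed prefix `P`,
those nonzero `b` such that some standard complex `C(P, b, rest) ≤ C`. -/
def candSet (C : PreCx) (P : List ℤ) : Set ℤ :=
  {b | b ≠ 0 ∧ ∃ rest : List ℤ, IsStdSeq (P ++ b :: rest) ∧ LocalLE (StdCx (P ++ b :: rest)) C}

/-- `a` is the sequence of numerical invariants `a_i(C)` (indexed from `0`):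
once a term vanishes all later terms vanish, and otherwise each term is
`sup^!` of the corresponding candidate set. -/
def InvSeq (C : PreCx) (a : ℕ → ℤ) : Prop :=
  ∀ k : ℕ,
    ((∃ i < k, a i = 0) → a k = 0) ∧
    ((∀ i < k, a i ≠ 0) → IsBangLUB (candSet C ((List.range k).map a)) (a k))

/-- The first `n` terms of `a`, with the (all-zero) tail deleted. -/
def truncSeq (a : ℕ → ℤ) (n : ℕ) : List ℤ :=
  ((List.range n).map a).takeWhile (fun b => b != 0)

/-! ### The homomorphisms `φ_j`, `P` and the shifts `sh_m` -/

/-- `φ_j` of a standard complex `C(a_1, …, a_n)`: the signed count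
`#{i odd : a_i = j} − #{i odd : a_i = −j}` (with 1-based odd `i`). -/
def phi (j : ℕ) (L : List ℤ) : ℤ :=
  ∑ i ∈ Finset.range L.length,
    if i % 2 = 0 then
      (if L.getD i 0 = (j : ℤ) then 1 else 0) - (if L.getD i 0 = -(j : ℤ) then 1 else 0)
    else 0

/-- The shift `sh_m` on parameter sequences: entries of absolute value `≥ m` are pushed
one further from zero; entries of absolute value `< m` are fixed. -/
def shSeq (m : ℕ) (L : List ℤ) : List ℤ :=
  L.map fun a => if (m : ℤ) ≤ a then a + 1 else if a ≤ -(m : ℤ) then a - 1 else a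

/-- `P(C) = -2 ∑_{j>0} j φ_j(C) + ∑_i sgn a_i`, computed from the parameter sequence of
the standard representative (the sum over `j` is finite since `φ_j` vanishes for
`j` larger than any `|a_i|`). -/
def Pval (L : List ℤ) : ℤ :=
  -2 * (∑ j ∈ Finset.range ((L.map Int.natAbs).sum + 1), (j : ℤ) * phi j L) +
    (L.map Int.sign).sum

end

section SplitOff

open Polynomial

/-! ### The ring `R` and its two quotients `𝔽₂[U]` and `𝔽₂[V]` -/

theorem Uv_mul_Vv : Uv * Vv = 0 := by
  rw [Uv, Vv, ← map_mul]
  exact Ideal.Quotient.eq_zero_iff_mem.mpr (Ideal.subset_span rfl)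

theorem RUV_add_self (r : RUV) : r + r = 0 := by
  have h : (2 : RUV) = 0 := by
    have h2 : (2 : PolyUV) = 0 := by
      have := congrArg (MvPolynomial.C (σ := Fin 2)) (show (2 : ZMod 2) = 0 from rfl)
      rwa [map_zero, map_ofNat] at this
    have := congrArg (Ideal.Quotient.mk IUV) h2
    rwa [map_zero, map_ofNat] at this
  rw [← two_mul, h, zero_mul]

theorem RUV_neg (r : RUV) : -r = r := (eq_neg_of_add_eq_zero_left (RUV_add_self r)).symm

/-- The quotient map from `R` to `𝔽₂[X]` which sends one of `U`, `V` to `X` (`U` if `c = 0`,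
`V` if `c = 1`) and kills the other one. -/
noncomputable def towerHom (c : ℕ) : RUV →+* (ZMod 2)[X] :=
  Ideal.Quotient.lift IUV
    (MvPolynomial.eval₂Hom Polynomial.C fun i : Fin 2 => if (i : ℕ) = c then X else 0) <| by
    suffices h : IUV ≤ RingHom.ker (MvPolynomial.eval₂Hom (Polynomial.C (R := ZMod 2))
        fun i : Fin 2 => if (i : ℕ) = c then X else 0) from fun a ha => h ha
    rw [IUV, Ideal.span_le, Set.singleton_subset_iff, SetLike.mem_coe, RingHom.mem_ker]
    rcases Nat.eq_zero_or_pos c with rfl | hc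
    · simp
    · simp [hc.ne]

theorem towerHom_Uv (c : ℕ) : towerHom c Uv = if c = 0 then X else 0 := by
  simp [towerHom, Uv, eq_comm]

theorem towerHom_Vv (c : ℕ) : towerHom c Vv = if c = 1 then X else 0 := by
  simp [towerHom, Vv, eq_comm]

/-! ### Homogeneous elements of `R` -/

theorem isHomog_zero (p q : ℤ) : IsHomog 0 p q := Or.inl rfl

theorem isHomog_one : IsHomog 1 0 0 := Or.inr (Or.inl ⟨0, by simp⟩)

theorem IsHomog.eq_one_of_towerHom {r : RUV} {p q : ℤ} (h : IsHomog r p q) {c : ℕ}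
    (h1 : (towerHom c r).coeff 0 ≠ 0) : r = 1 := by
  rcases h with rfl | ⟨a, rfl, -, -⟩ | ⟨a, rfl, -, -⟩
  · simp at h1
  · rcases Nat.eq_zero_or_pos a with rfl | ha
    · simp
    · rw [map_pow, towerHom_Uv] at h1
      split_ifs at h1 <;> simp [coeff_X_pow, ha.ne, ha.ne', zero_pow] at h1
  · rcases Nat.eq_zero_or_pos a with rfl | ha
    · simp
    · rw [map_pow, towerHom_Vv] at h1
      split_ifs at h1 <;> simp [coeff_X_pow, ha.ne, ha.ne', zero_pow] at h1

theorem IsHomog.eq_zero_of_towerHom {r : RUV} {p q : ℤ} (h : IsHomog r p q)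
    (h0 : towerHom 0 r = 0) (h1 : towerHom 1 r = 0) : r = 0 := by
  rcases h with rfl | ⟨a, rfl, -, -⟩ | ⟨a, rfl, -, -⟩
  · rfl
  · simp [towerHom_Uv] at h0
  · simp [towerHom_Vv] at h1

theorem IsHomog.degree_of_eq_one {p q : ℤ} (h : IsHomog 1 p q) : p = 0 ∧ q = 0 := by
  have key : ∀ (c a : ℕ), (1 : (ZMod 2)[X]) = X ^ a → a = 0 := fun _ a h => by
    simpa using (congrArg natDegree h).symm
  rcases h with h | ⟨a, h, hp, hq⟩ | ⟨a, h, hp, hq⟩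
  · exact absurd (congrArg (towerHom 0) h) (by simp)
  · have := key 0 a (by simpa [towerHom_Uv] using congrArg (towerHom 0) h)
    subst this; simpa using ⟨hp, hq⟩
  · have := key 0 a (by simpa [towerHom_Vv] using congrArg (towerHom 1) h)
    subst this; simpa using ⟨hp, hq⟩

theorem IsHomog.add {r r' : RUV} {p q : ℤ} (h : IsHomog r p q) (h' : IsHomog r' p q) :
    IsHomog (r + r') p q := by
  rcases h with rfl | h
  · rwa [zero_add]
  rcases h' with rfl | h'
  · rw [add_zero]; exact Or.inr h
  refine Or.inl ?_
  suffices r = r' by rw [this, RUV_add_self]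
  rcases h with ⟨a, rfl, hp, hq⟩ | ⟨a, rfl, hp, hq⟩ <;>
    rcases h' with ⟨b, rfl, hp', hq'⟩ | ⟨b, rfl, hp', hq'⟩
  · rw [show a = b by omega]
  · rw [show a = 0 by omega, show b = 0 by omega]; simp
  · rw [show a = 0 by omega, show b = 0 by omega]; simp
  · rw [show a = b by omega]

theorem IsHomog.mul {r r' : RUV} {p q p' q' : ℤ} (h : IsHomog r p q) (h' : IsHomog r' p' q') :
    IsHomog (r * r') (p + p') (q + q') := by
  have mixed : ∀ a b : ℕ, Uv ^ (a + 1) * Vv ^ (b + 1) = 0 := fun a b => by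
    rw [pow_succ, pow_succ, mul_mul_mul_comm, Uv_mul_Vv, mul_zero]
  rcases h with rfl | ⟨a, rfl, rfl, rfl⟩ | ⟨a, rfl, rfl, rfl⟩
  · exact Or.inl (zero_mul _)
  · rcases h' with rfl | ⟨b, rfl, rfl, rfl⟩ | ⟨b, rfl, rfl, rfl⟩
    · exact Or.inl (mul_zero _)
    · exact Or.inr (Or.inl ⟨a + b, (pow_add _ _ _).symm, by push_cast; ring, rfl⟩)
    · rcases a with _ | a
      · exact Or.inr (Or.inr ⟨b, by simp, by simp, by simp⟩)
      rcases b with _ | b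
      · exact Or.inr (Or.inl ⟨a + 1, by simp, by simp, by simp⟩)
      · exact Or.inl (mixed a b)
  · rcases h' with rfl | ⟨b, rfl, rfl, rfl⟩ | ⟨b, rfl, rfl, rfl⟩
    · exact Or.inl (mul_zero _)
    · rcases a with _ | a
      · exact Or.inr (Or.inl ⟨b, by simp, by simp, by simp⟩)
      rcases b with _ | b
      · exact Or.inr (Or.inr ⟨a + 1, by simp, by simp, by simp⟩)
      · exact Or.inl (by rw [mul_comm, mixed b a])
    · exact Or.inr (Or.inr ⟨a + b, (pow_add _ _ _).symm, rfl, by push_cast; ring⟩)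

theorem isHomog_sum {ι : Type*} (s : Finset ι) {r : ι → RUV} {p q : ℤ}
    (h : ∀ i ∈ s, IsHomog (r i) p q) : IsHomog (∑ i ∈ s, r i) p q :=
  Finset.sum_induction _ (fun r => IsHomog r p q) (fun _ _ => IsHomog.add) (isHomog_zero p q) h

theorem finite_isHomog (p q : ℤ) : {r : RUV | IsHomog r p q}.Finite := by
  refine Set.Finite.subset
    (Set.toFinite {0, Uv ^ (-p / 2).toNat, Vv ^ (-q / 2).toNat}) fun r hr => ?_
  rcases hr with rfl | ⟨a, rfl, rfl, rfl⟩ | ⟨a, rfl, rfl, rfl⟩ <;> simp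

/-! ### Homogeneous matrices -/

/-- The matrix `M` represents a map of bidegree `(s, t)` between free modules whose bases have
bigradings `g₁` and `g₂`; the rows of `M` are the images of the basis vectors. -/
def HomogMat {ι κ : Type*} (g₁ : ι → ℤ × ℤ) (g₂ : κ → ℤ × ℤ) (s t : ℤ) (M : Matrix ι κ RUV) :
    Prop :=
  ∀ i j, IsHomog (M i j) ((g₁ i).1 + s - (g₂ j).1) ((g₁ i).2 + t - (g₂ j).2)

section HomogMat

variable {ι κ μ : Type*} {g₁ : ι → ℤ × ℤ} {g₂ : κ → ℤ × ℤ} {g₃ : μ → ℤ × ℤ} {s t s' t' : ℤ}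

theorem homogMat_one [DecidableEq ι] : HomogMat g₁ g₁ 0 0 1 := fun i j => by
  by_cases h : i = j
  · subst h
    simpa using isHomog_one
  · simpa [Matrix.one_apply_ne h] using isHomog_zero _ _

theorem HomogMat.add {M N : Matrix ι κ RUV} (hM : HomogMat g₁ g₂ s t M)
    (hN : HomogMat g₁ g₂ s t N) : HomogMat g₁ g₂ s t (M + N) :=
  fun i j => (hM i j).add (hN i j)

theorem HomogMat.mul [Fintype κ] {M : Matrix ι κ RUV} {N : Matrix κ μ RUV}
    (hM : HomogMat g₁ g₂ s t M) (hN : HomogMat g₂ g₃ s' t' N) :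
    HomogMat g₁ g₃ (s + s') (t + t') (M * N) := fun i j => by
  rw [Matrix.mul_apply]
  refine isHomog_sum _ fun k _ => ?_
  convert (hM i k).mul (hN k j) using 1 <;> ring

theorem HomogMat.pow [Fintype ι] [DecidableEq ι] {M : Matrix ι ι RUV}
    (hM : HomogMat g₁ g₁ 0 0 M) (k : ℕ) : HomogMat g₁ g₁ 0 0 (M ^ k) := by
  induction k with
  | zero => simpa using homogMat_one
  | succ k ih => simpa [pow_succ] using ih.mul hM

theorem finite_homogMat [Finite ι] [Finite κ] : {M | HomogMat g₁ g₂ s t M}.Finite := by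
  have := Set.Finite.pi' fun i : ι => Set.Finite.pi' fun j : κ =>
    finite_isHomog ((g₁ i).1 + s - (g₂ j).1) ((g₁ i).2 + t - (g₂ j).2)
  exact this

theorem matrix_RUV_neg (M : Matrix ι κ RUV) : -M = M := by
  ext i j; exact RUV_neg _

/-- A homogeneous endomorphism whose determinant has invertible constant term has finite
order. -/
theorem HomogMat.exists_pow_eq_one [Fintype ι] [DecidableEq ι] {M : Matrix ι ι RUV}
    (hM : HomogMat g₁ g₁ 0 0 M) (hdet : ∀ c, towerHom c M.det ≠ 0) :
    ∃ k, M ^ (k + 1) = 1 := by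
  obtain ⟨a, b, hab, h⟩ := Set.Finite.exists_lt_map_eq_of_forall_mem
    (f := fun k : ℕ => M ^ k) (fun k => hM.pow k) finite_homogMat
  obtain ⟨k, rfl⟩ := Nat.exists_eq_add_of_lt hab
  refine ⟨k, ?_⟩
  have hz : M ^ a * (M ^ (k + 1) + 1) = 0 := by
    rw [mul_add, ← pow_add, ← add_assoc, mul_one, ← h]
    simpa [matrix_RUV_neg] using add_neg_cancel (M ^ a)
  have hd : M.det ^ a • (M ^ (k + 1) + 1) = 0 := by
    rw [← Matrix.det_pow, ← Matrix.one_mul (M ^ (k + 1) + 1), ← Matrix.smul_mul,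
      ← Matrix.adjugate_mul, Matrix.mul_assoc, hz, Matrix.mul_zero]
  have hc : ∀ c i j, towerHom c ((M ^ (k + 1) + 1) i j) = 0 := fun c i j => by
    have := congrArg (towerHom c) (congrFun (congrFun hd i) j)
    rw [Matrix.smul_apply, smul_eq_mul, map_mul, map_pow, Matrix.zero_apply, map_zero] at this
    exact (mul_eq_zero.mp this).resolve_left (pow_ne_zero _ (hdet c))
  have : M ^ (k + 1) + 1 = 0 := by
    ext i j
    exact IsHomog.eq_zero_of_towerHom (((hM.pow (k + 1)).add homogMat_one) i j) (hc 0 i j)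
      (hc 1 i j)
  rw [← matrix_RUV_neg (1 : Matrix ι ι RUV)]
  exact eq_neg_of_add_eq_zero_left this

end HomogMat

/-! ### Self-maps of standard complexes -/

section Standard

variable {L : List ℤ}

theorem grRel_fst_emod_two (L : List ℤ) (i : ℕ) : (grRel L i).1 % 2 = (i : ℤ) % 2 := by
  induction i with
  | zero => simp [grRel]
  | succ i ih =>
    have h : (grRel L (i + 1)).1 = (grRel L i).1 + (stepShift i (L.getD i 0)).1 := by
      simp [grRel, Finset.sum_range_succ]
    have h' : (stepShift i (L.getD i 0)).1 % 2 = 1 := by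
      unfold stepShift
      split_ifs <;> simp
    push_cast
    omega

theorem towerHom_stdDm {c : ℕ} (hc : c < 2) (i j : Fin (L.length + 1)) :
    towerHom c (stdDm L i j) =
      if (j : ℕ) = i + 1 ∧ L.getD i 0 < 0 ∧ (i : ℕ) % 2 = c then X ^ (L.getD i 0).natAbs
      else if (i : ℕ) = j + 1 ∧ 0 < L.getD j 0 ∧ (j : ℕ) % 2 = c then X ^ (L.getD j 0).natAbs
      else 0 := by
  have key : ∀ (k : ℕ) (a : ℤ), a ≠ 0 →
      towerHom c ((if k % 2 = 0 then Uv else Vv) ^ a.natAbs) =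
        if k % 2 = c then X ^ a.natAbs else 0 := fun k a ha => by
    rw [map_pow, apply_ite (towerHom c), towerHom_Uv, towerHom_Vv]
    have h0 := zero_pow (M₀ := (ZMod 2)[X]) (Int.natAbs_ne_zero.mpr ha)
    split_ifs <;> first | rfl | exact h0 | omega
  unfold stdDm
  by_cases h1 : (j : ℕ) = i + 1 ∧ L.getD i 0 < 0
  · rw [if_pos h1, key _ _ h1.2.ne]
    split_ifs <;> first | rfl | omega
  · rw [if_neg h1]
    by_cases h2 : (i : ℕ) = j + 1 ∧ 0 < L.getD j 0
    · rw [if_pos h2, key _ _ h2.2.ne']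
      split_ifs <;> first | rfl | omega
    · rw [if_neg h2, map_zero]
      split_ifs <;> first | rfl | omega

theorem towerHom_stdDm_left {c : ℕ} (hc : c < 2) {i : Fin (L.length + 1)} (hi : (i : ℕ) % 2 = c)
    (k : Fin (L.length + 1)) : towerHom c (stdDm L i k) =
      if (k : ℕ) = i + 1 ∧ L.getD i 0 < 0 then X ^ (L.getD i 0).natAbs else 0 := by
  rw [towerHom_stdDm hc]
  split_ifs <;> first | rfl | omega

theorem towerHom_stdDm_right {c : ℕ} (hc : c < 2) {j : Fin (L.length + 1)} (hj : (j : ℕ) % 2 = c)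
    (k : Fin (L.length + 1)) : towerHom c (stdDm L k j) =
      if (k : ℕ) = j + 1 ∧ 0 < L.getD j 0 then X ^ (L.getD j 0).natAbs else 0 := by
  rw [towerHom_stdDm hc]
  split_ifs <;> first | rfl | omega

theorem towerHom_stdDm_succ_left {c : ℕ} (hc : c < 2) {i i' : Fin (L.length + 1)}
    (hi : (i : ℕ) % 2 = c) (hi' : (i' : ℕ) = i + 1) (k : Fin (L.length + 1)) :
    towerHom c (stdDm L i' k) =
      if k = i ∧ 0 < L.getD i 0 then X ^ (L.getD i 0).natAbs else 0 := by
  rw [towerHom_stdDm hc]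
  by_cases hk : k = i
  · subst hk
    split_ifs <;> first | rfl | omega
  · have : (k : ℕ) ≠ i := fun h => hk (Fin.ext h)
    split_ifs <;> first | rfl | omega

theorem towerHom_stdDm_succ_right {c : ℕ} (hc : c < 2) {j j' : Fin (L.length + 1)}
    (hj : (j : ℕ) % 2 = c) (hj' : (j' : ℕ) = j + 1) (k : Fin (L.length + 1)) :
    towerHom c (stdDm L k j') =
      if k = j ∧ L.getD j 0 < 0 then X ^ (L.getD j 0).natAbs else 0 := by
  rw [towerHom_stdDm hc]
  by_cases hk : k = j
  · subst hk
    split_ifs <;> first | rfl | omega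
  · have : (k : ℕ) ≠ j := fun h => hk (Fin.ext h)
    split_ifs <;> first | rfl | omega

theorem exists_succ_of_getD_ne_zero {i : Fin (L.length + 1)} (h : L.getD i 0 ≠ 0) :
    ∃ i' : Fin (L.length + 1), (i' : ℕ) = i + 1 := by
  have : (i : ℕ) < L.length := by
    by_contra hi
    exact h (List.getD_eq_default _ _ (by omega))
  exact ⟨⟨i + 1, by omega⟩, rfl⟩

theorem qval_neg {a : ℤ} (h : a < 0) : qval a < 0 := by
  have : (a : ℚ) < 0 := by exact_mod_cast h
  rw [qval, if_neg h.ne]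
  exact one_div_neg.mpr this

theorem qval_pos {a : ℤ} (h : 0 < a) : 0 < qval a := by
  have : (0 : ℚ) < a := by exact_mod_cast h
  rw [qval, if_neg h.ne']
  exact one_div_pos.mpr this

theorem qval_zero : qval 0 = 0 := if_pos rfl

theorem qval_injective : Function.Injective qval := fun a b h => by
  have hz : ∀ {a : ℤ}, qval a = 0 → a = 0 := fun {a} h => by
    by_contra ha
    rcases lt_or_gt_of_ne ha with ha | ha
    · exact (qval_neg ha).ne h
    · exact (qval_pos ha).ne' h
  by_cases ha : a = 0
  · rw [ha, qval_zero] at h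
    rw [ha, hz h.symm]
  · by_cases hb : b = 0
    · rw [hb, qval_zero] at h
      exact absurd (hz h) ha
    · rw [qval, qval, if_neg ha, if_neg hb] at h
      have : (a : ℚ) ≠ 0 := by exact_mod_cast ha
      have : (b : ℚ) ≠ 0 := by exact_mod_cast hb
      field_simp at h
      exact_mod_cast h.symm

theorem qval_le_of_pos {a b : ℤ} (hb : 0 < b) (h : b ≤ a) : qval a ≤ qval b := by
  have hb' : (0 : ℚ) < b := by exact_mod_cast hb
  rw [qval, qval, if_neg (hb.trans_le h).ne', if_neg hb.ne']
  exact one_div_le_one_div_of_le hb' (by exact_mod_cast h)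

theorem qval_le_of_neg {a b : ℤ} (ha : a < 0) (h : b ≤ a) : qval a ≤ qval b := by
  have ha' : (a : ℚ) < 0 := by exact_mod_cast ha
  rw [qval, qval, if_neg (h.trans_lt ha).ne, if_neg ha.ne]
  exact one_div_le_one_div_of_neg_of_le ha' (by exact_mod_cast h)

/-- If the coefficient of `x_j` in the image of `x_i` under a chain map `M` is `1`, then the
parameter following `x_i` is at most the one following `x_j`; if these are equal then the
coefficient of `x_{j+1}` in the image of `x_{i+1}` is `1` as well. -/
theorem qval_le_of_apply_eq_one {s t : ℤ}
    {M : Matrix (Fin (L.length + 1)) (Fin (L.length + 1)) RUV}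
    (hM : HomogMat (stdGr L) (stdGr L) s t M)
    (hch : Matrix.of (stdDm L) * M = M * Matrix.of (stdDm L))
    {i j : Fin (L.length + 1)} (hij : (i : ℕ) % 2 = (j : ℕ) % 2) (h1 : M i j = 1) :
    qval (L.getD i 0) ≤ qval (L.getD j 0) ∧
      (L.getD i 0 = L.getD j 0 → ∀ i' j' : Fin (L.length + 1), (i' : ℕ) = i + 1 →
        (j' : ℕ) = j + 1 → L.getD i 0 ≠ 0 → M i' j' = 1) := by
  obtain ⟨c, hci⟩ : ∃ c, (i : ℕ) % 2 = c := ⟨_, rfl⟩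
  have hcj : (j : ℕ) % 2 = c := hij ▸ hci
  have hc : c < 2 := hci ▸ Nat.mod_lt _ two_pos
  have hmul : ∀ k l, ∑ m, towerHom c (stdDm L k m) * towerHom c (M m l) =
      ∑ m, towerHom c (M k m) * towerHom c (stdDm L m l) := fun k l => by
    simpa [Matrix.mul_apply] using congrArg (towerHom c) (congrFun (congrFun hch k) l)
  have hone : ∀ {k l}, towerHom c (M k l) = 1 → M k l = 1 := fun {k l} h =>
    (hM k l).eq_one_of_towerHom (c := c) (by simp [h])
  have hPij : towerHom c (M i j) = 1 := by rw [h1, map_one]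
  rcases lt_trichotomy (L.getD i 0) 0 with hi | hi | hi
  · obtain ⟨i', hi'⟩ := exists_succ_of_getD_ne_zero hi.ne
    rcases lt_or_ge (L.getD j 0) 0 with hj | hj
    · have key : ∀ j' : Fin (L.length + 1), (j' : ℕ) = j + 1 →
          X ^ (L.getD i 0).natAbs * towerHom c (M i' j') = X ^ (L.getD j 0).natAbs := by
        intro j' hj'
        have := hmul i j'
        simp only [towerHom_stdDm_left hc hci, towerHom_stdDm_succ_right hc hcj hj', hi, hj,
          and_true, ← hi', Fin.val_inj, ite_mul, mul_ite, zero_mul, mul_zero,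
          Finset.sum_ite_eq', Finset.mem_univ, if_true, hPij, one_mul] at this
        exact this
      refine ⟨qval_le_of_neg hi ?_, fun heq i'' j' hi'' hj' _ => ?_⟩
      · obtain ⟨j', hj'⟩ := exists_succ_of_getD_ne_zero hj.ne
        have h := dvd_of_mul_right_eq _ (key j' hj')
        have := (pow_dvd_pow_iff X_ne_zero not_isUnit_X).mp h
        omega
      · obtain rfl : i'' = i' := Fin.ext (by omega)
        have h := key j' hj'
        rw [← heq] at h
        exact hone (mul_left_cancel₀ (pow_ne_zero _ X_ne_zero) (h.trans (mul_one _).symm))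
    · refine ⟨(qval_neg hi).le.trans ?_, fun heq => absurd heq (by omega)⟩
      rcases hj.eq_or_lt with hj | hj
      · rw [← hj, qval_zero]
      · exact (qval_pos hj).le
  · refine ⟨?_, fun _ _ _ _ _ h => absurd hi h⟩
    rw [hi, qval_zero]
    rcases lt_trichotomy (L.getD j 0) 0 with hj | hj | hj
    · obtain ⟨j', hj'⟩ := exists_succ_of_getD_ne_zero hj.ne
      have := hmul i j'
      simp [towerHom_stdDm_left hc hci, towerHom_stdDm_succ_right hc hcj hj', hi, hj, hPij,
        -List.getD_eq_getElem?_getD] at this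
      exact absurd this.symm (pow_ne_zero _ X_ne_zero)
    · rw [hj, qval_zero]
    · exact (qval_pos hj).le
  · obtain ⟨i', hi'⟩ := exists_succ_of_getD_ne_zero hi.ne'
    have key := hmul i' j
    simp only [towerHom_stdDm_succ_left hc hci hi', towerHom_stdDm_right hc hcj, hi, and_true,
      ite_mul, mul_ite, zero_mul, mul_zero, Finset.sum_ite_eq', Finset.mem_univ, if_true, hPij,
      mul_one] at key
    have hj : 0 < L.getD j 0 := by
      by_contra hj
      simp [hj, -List.getD_eq_getElem?_getD] at key
    obtain ⟨j', hj'⟩ := exists_succ_of_getD_ne_zero hj.ne'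
    simp only [hj, and_true, ← hj', Fin.val_inj, Finset.sum_ite_eq', Finset.mem_univ,
      if_true] at key
    refine ⟨qval_le_of_pos hj ?_, fun heq i'' j'' hi'' hj'' _ => ?_⟩
    · have := (pow_dvd_pow_iff X_ne_zero not_isUnit_X).mp (dvd_of_mul_left_eq _ key.symm)
      omega
    · obtain rfl : i'' = i' := Fin.ext (by omega)
      obtain rfl : j'' = j' := Fin.ext (by omega)
      rw [heq] at key
      exact hone (mul_right_cancel₀ (pow_ne_zero _ X_ne_zero) (key.symm.trans (one_mul _).symm))

/-- The sort key of a generator of a standard complex: its parity, followed by the parameters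
to its right, compared lexicographically in the order of `Z^!`. -/
def stdKey (L : List ℤ) (i : ℕ) : Lex (ℕ → ℚ) :=
  toLex fun k => Nat.casesOn k ((i % 2 : ℕ) : ℚ) fun k => qval (L.getD (i + k) 0)

theorem stdKey_zero (L : List ℤ) (i : ℕ) : ofLex (stdKey L i) 0 = ((i % 2 : ℕ) : ℚ) := rfl

theorem stdKey_succ (L : List ℤ) (i k : ℕ) :
    ofLex (stdKey L i) (k + 1) = qval (L.getD (i + k) 0) := rfl

theorem stdKey_injective (hL : ∀ b ∈ L, b ≠ 0) {i j : Fin (L.length + 1)}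
    (h : stdKey L i = stdKey L j) : i = j := by
  have aux : ∀ {i j : Fin (L.length + 1)}, stdKey L i = stdKey L j → ¬ (i : ℕ) < j := by
    intro i j h hlt
    have := congrFun (congrArg ofLex h) (L.length - j + 1)
    rw [stdKey_succ, stdKey_succ] at this
    have h' := qval_injective this
    rw [List.getD_eq_default L (n := j + (L.length - j)) _ (by omega),
      List.getD_eq_getElem L _ (show (i : ℕ) + (L.length - j) < L.length by omega)] at h'
    exact hL _ (List.getElem_mem _) h'
  exact Fin.ext (le_antisymm (not_lt.mp (aux h.symm)) (not_lt.mp (aux h)))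

/-- A homogeneous chain self-map of a standard complex is triangular modulo `(U, V)`. -/
theorem stdKey_le_of_apply_eq_one {t : ℤ}
    {M : Matrix (Fin (L.length + 1)) (Fin (L.length + 1)) RUV}
    (hL : ∀ b ∈ L, b ≠ 0)
    (hM : HomogMat (stdGr L) (stdGr L) 0 t M)
    (hch : Matrix.of (stdDm L) * M = M * Matrix.of (stdDm L))
    {i j : Fin (L.length + 1)} (h1 : M i j = 1) : stdKey L i ≤ stdKey L j := by
  have hpar : (i : ℕ) % 2 = (j : ℕ) % 2 := by
    have := (h1 ▸ hM i j).degree_of_eq_one.1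
    simp only [stdGr] at this
    have hi := grRel_fst_emod_two L i
    have hj := grRel_fst_emod_two L j
    omega
  by_contra hlt
  obtain ⟨n, heq, hn⟩ := not_le.mp hlt
  rcases n with _ | n
  · change ofLex (stdKey L j) 0 < ofLex (stdKey L i) 0 at hn
    rw [stdKey_zero, stdKey_zero, hpar] at hn
    exact lt_irrefl _ hn
  have heq' : ∀ k < n, L.getD (i + k) 0 = L.getD (j + k) 0 := fun k hk =>
    qval_injective (heq (k + 1) (by omega)).symm
  change qval (L.getD (j + n) 0) < qval (L.getD (i + n) 0) at hn
  have hlen : ∀ m, L.getD m 0 = 0 → L.length ≤ m := fun m hm => by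
    by_contra hlt
    rw [List.getD_eq_getElem L _ (not_le.mp hlt)] at hm
    exact hL _ (List.getElem_mem _) hm
  have hne : ∀ k < n, L.getD (i + k) 0 ≠ 0 := fun k hk h0 => by
    have hi := hlen _ h0
    have hj := hlen _ (heq' k hk ▸ h0)
    rw [List.getD_eq_default _ _ (by omega), List.getD_eq_default _ _ (by omega)] at hn
    exact lt_irrefl _ hn
  have hlt : ∀ m, L.getD m 0 ≠ 0 → m < L.length := fun m hm => by
    by_contra hle
    exact hm (List.getD_eq_default _ _ (not_lt.mp hle))
  have hbound : (i : ℕ) + n < L.length + 1 ∧ (j : ℕ) + n < L.length + 1 := by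
    rcases n with _ | m
    · exact ⟨i.isLt, j.isLt⟩
    · have h := hne m (Nat.lt_succ_self m)
      have hi := hlt _ h
      have hj := hlt _ (heq' m (Nat.lt_succ_self m) ▸ h)
      omega
  have walk : ∀ k ≤ n, ∀ i' j' : Fin (L.length + 1), (i' : ℕ) = i + k → (j' : ℕ) = j + k →
      M i' j' = 1 := by
    intro k
    induction k with
    | zero =>
      intro _ i' j' hi' hj'
      rwa [show i' = i from Fin.ext hi', show j' = j from Fin.ext hj']
    | succ k ih =>
      intro hk i' j' hi' hj'
      have hi'' := i'.isLt
      have hj'' := j'.isLt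
      exact (qval_le_of_apply_eq_one hM hch (i := ⟨i + k, by omega⟩) (j := ⟨j + k, by omega⟩)
        (by simp; omega) (ih (by omega) _ _ rfl rfl)).2 (heq' k (by omega)) i' j'
        hi' hj' (hne k (by omega))
  exact absurd (qval_le_of_apply_eq_one hM hch (i := ⟨i + n, hbound.1⟩) (j := ⟨j + n, hbound.2⟩)
    (by simp; omega) (walk n le_rfl _ _ rfl rfl)).1 (not_le.mpr hn)

/-- A homogeneous chain self-map of a standard complex which fixes `x_0` modulo the other
generators has determinant with constant term `1`. -/
theorem towerHom_det_ne_zero {t : ℤ}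
    {M : Matrix (Fin (L.length + 1)) (Fin (L.length + 1)) RUV}
    (hL : ∀ b ∈ L, b ≠ 0)
    (hM : HomogMat (stdGr L) (stdGr L) 0 t M)
    (hch : Matrix.of (stdDm L) * M = M * Matrix.of (stdDm L))
    (h0 : M 0 0 = 1) (c : ℕ) : towerHom c M.det ≠ 0 := by
  have hdiag : ∀ k (i : Fin (L.length + 1)), (i : ℕ) = k → M i i = 1 := by
    intro k
    induction k with
    | zero =>
      intro i hi
      rwa [show i = 0 from Fin.ext hi]
    | succ k ih =>
      intro i hi
      have hk : k < L.length := by omega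
      refine (qval_le_of_apply_eq_one hM hch (i := ⟨k, by omega⟩) rfl (ih _ rfl)).2 rfl i i hi hi ?_
      change L.getD k 0 ≠ 0
      rw [List.getD_eq_getElem L _ hk]
      exact hL _ (List.getElem_mem _)
  let ε : RUV →+* ZMod 2 := constantCoeff.comp (towerHom c)
  have htri : (M.map ε).BlockTriangular (fun i => stdKey L i) := by
    intro i j hij
    by_contra hne
    have h1 : M i j = 1 := (hM i j).eq_one_of_towerHom (c := c) hne
    exact absurd (stdKey_le_of_apply_eq_one hL hM hch h1) (not_le.mpr hij)
  have hdet : (M.map ε).det = 1 := by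
    classical
    rw [htri.det]
    refine Finset.prod_eq_one fun a _ => ?_
    have : (M.map ε).toSquareBlock (fun i : Fin (L.length + 1) => stdKey L i) a = 1 := by
      ext ⟨i, hi⟩ ⟨j, hj⟩
      obtain rfl : i = j := stdKey_injective hL (hi.trans hj.symm)
      rw [Matrix.one_apply_eq, Matrix.toSquareBlock_def, Matrix.of_apply, Matrix.map_apply,
        hdiag _ i rfl, map_one]
    rw [this, Matrix.det_one]
  intro hz
  have : ε M.det = 1 := by rw [RingHom.map_det]; exact hdet
  rw [RingHom.comp_apply, hz, map_zero] at this
  exact zero_ne_one this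

end Standard

/-! ### Maps of free modules as matrices -/

section MatMap

variable {m n l : ℕ}

/-- The linear map between free `R`-modules which sends the basis vectors to the rows of `M`. -/
noncomputable def matMap (M : Matrix (Fin m) (Fin n) RUV) :
    (Fin m →₀ RUV) →ₗ[RUV] (Fin n →₀ RUV) :=
  Finsupp.linearCombination RUV fun i => ∑ j, Finsupp.single j (M i j)

/-- The matrix of a linear map between free `R`-modules, with rows the images of the basis. -/
noncomputable def mapMat (f : (Fin m →₀ RUV) →ₗ[RUV] (Fin n →₀ RUV)) : Matrix (Fin m) (Fin n) RUV :=
  fun i j => f (Finsupp.single i 1) j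

theorem dmap_eq_matMap (C : PreCx) : dmap C = matMap (Matrix.of C.dm) := rfl

theorem matMap_single_apply (M : Matrix (Fin m) (Fin n) RUV) (i : Fin m) (j : Fin n) :
    matMap M (Finsupp.single i 1) j = M i j := by
  simp [matMap, Finsupp.linearCombination_single, Finsupp.finsetSum_apply, Finsupp.single_apply]

theorem mapMat_matMap (M : Matrix (Fin m) (Fin n) RUV) : mapMat (matMap M) = M := by
  ext i j; exact matMap_single_apply M i j

theorem matMap_mapMat (f : (Fin m →₀ RUV) →ₗ[RUV] (Fin n →₀ RUV)) : matMap (mapMat f) = f := by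
  refine Finsupp.lhom_ext' fun i => LinearMap.ext_ring ?_
  ext j
  exact matMap_single_apply _ i j

theorem matMap_apply (M : Matrix (Fin m) (Fin n) RUV) (x : Fin m →₀ RUV) (j : Fin n) :
    matMap M x j = ∑ i, x i * M i j := by
  rw [matMap, Finsupp.linearCombination_apply, Finsupp.sum_fintype _ _ (by simp),
    Finsupp.finsetSum_apply]
  simp [Finsupp.single_apply]

theorem matMap_mul (M : Matrix (Fin m) (Fin n) RUV) (N : Matrix (Fin n) (Fin l) RUV)
    (x : Fin m →₀ RUV) : matMap (M * N) x = matMap N (matMap M x) := by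
  suffices matMap (M * N) = (matMap N).comp (matMap M) by rw [this]; rfl
  refine Finsupp.lhom_ext' fun i => LinearMap.ext_ring ?_
  ext j
  change matMap (M * N) (Finsupp.single i 1) j = matMap N (matMap M (Finsupp.single i 1)) j
  rw [matMap_single_apply, matMap_apply, Matrix.mul_apply]
  simp only [matMap_single_apply]

theorem matMap_add (M N : Matrix (Fin m) (Fin n) RUV) (x : Fin m →₀ RUV) :
    matMap (M + N) x = matMap M x + matMap N x := by
  ext j
  simp only [Finsupp.add_apply, matMap_apply, Matrix.add_apply, mul_add, Finset.sum_add_distrib]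

theorem matMap_zero (x : Fin m →₀ RUV) : matMap (0 : Matrix (Fin m) (Fin n) RUV) x = 0 := by
  ext j
  simp [matMap_apply]

theorem matMap_one (x : Fin m →₀ RUV) : matMap (1 : Matrix (Fin m) (Fin m) RUV) x = x := by
  ext j
  simp [matMap_apply, Matrix.one_apply]

theorem finsupp_RUV_neg (x : Fin m →₀ RUV) : -x = x := by
  ext j; exact RUV_neg _

end MatMap

/-! ### Homotopy equivalences from matrices -/

theorem HomogMat.mapHomogShift {C₁ C₂ : PreCx} {s t : ℤ} {M : Matrix (Fin C₁.n) (Fin C₂.n) RUV}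
    (hM : HomogMat C₁.gr C₂.gr s t M) : MapHomogShift C₁ C₂ (matMap M) s t := fun i j => by
  rw [matMap_single_apply]
  exact hM i j

theorem homotopyEquivCx_of_matrix {C B : PreCx} {K : Type*} [Fintype K] [DecidableEq K]
    (e : Fin B.n ≃ K) {g : K → ℤ × ℤ} {D : Matrix K K RUV} (hg : ∀ p, B.gr p = g (e p))
    (hD : Matrix.of B.dm = D.submatrix e e)
    {Φ : Matrix (Fin C.n) K RUV} {Ψ : Matrix K (Fin C.n) RUV} {H : Matrix K K RUV}
    (hΦ : HomogMat C.gr g 0 0 Φ) (hΨ : HomogMat g C.gr 0 0 Ψ) (hH : HomogMat g g 1 1 H)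
    (hΦc : Matrix.of C.dm * Φ = Φ * D) (hΨc : D * Ψ = Ψ * Matrix.of C.dm)
    (hΦΨ : Φ * Ψ = 1) (hΨΦ : Ψ * Φ + 1 = H * D + D * H) : HomotopyEquivCx C B := by
  refine ⟨matMap (Φ.submatrix id e), matMap (Ψ.submatrix e id), 0, matMap (H.submatrix e e),
    fun x => ?_, fun x => ?_, ?_, ?_, fun i j => isHomog_zero _ _, ?_, fun x => ?_, fun x => ?_⟩
  · rw [dmap_eq_matMap, dmap_eq_matMap, ← matMap_mul, ← matMap_mul, hD,
      Matrix.submatrix_mul_equiv, ← hΦc]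
    rfl
  · rw [dmap_eq_matMap, dmap_eq_matMap, ← matMap_mul, ← matMap_mul, hD,
      Matrix.submatrix_mul_equiv, hΨc]
    rfl
  · refine HomogMat.mapHomogShift fun i j => ?_
    rw [hg]
    exact hΦ i (e j)
  · refine HomogMat.mapHomogShift fun i j => ?_
    rw [hg]
    exact hΨ (e i) j
  · refine HomogMat.mapHomogShift fun i j => ?_
    rw [hg, hg]
    exact hH (e i) (e j)
  · rw [← matMap_mul, Matrix.submatrix_mul_equiv, hΦΨ, Matrix.submatrix_id_id, matMap_one]
    simp
  · have h : (Ψ.submatrix e id) * (Φ.submatrix id e) + 1 =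
        H.submatrix e e * Matrix.of B.dm + Matrix.of B.dm * H.submatrix e e := by
      rw [hD, Matrix.submatrix_mul_equiv, Matrix.submatrix_mul_equiv]
      change _ = (H * D + D * H).submatrix e e
      rw [← hΨΦ]
      ext i j
      simp [Matrix.mul_apply, Matrix.one_apply]
    rw [← matMap_mul, dmap_eq_matMap, ← matMap_mul, ← matMap_mul, ← matMap_add, ← h, matMap_add,
      matMap_one, sub_eq_add_neg, finsupp_RUV_neg]

/-! ### Splitting off a retract by means of the mapping cone -/

/-- The bigrading on the mapping cone of a map `S → C` of bidegree `(0, 0)`. -/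
noncomputable def coneGr (C S : PreCx) : Fin C.n ⊕ Fin S.n → ℤ × ℤ :=
  Sum.elim C.gr fun i => S.gr i + (1, 1)

/-- The differential of the mapping cone of `G : S → C`. -/
noncomputable def coneMat {C S : PreCx} (G : Matrix (Fin S.n) (Fin C.n) RUV) :
    Matrix (Fin C.n ⊕ Fin S.n) (Fin C.n ⊕ Fin S.n) RUV :=
  Matrix.fromBlocks (Matrix.of C.dm) 0 G (Matrix.of S.dm)

/-- The mapping cone of `G : S → C`. -/
noncomputable def coneCx {C S : PreCx} (G : Matrix (Fin S.n) (Fin C.n) RUV) : PreCx where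
  n := C.n + S.n
  gr p := coneGr C S (finSumFinEquiv.symm p)
  dm p q := coneMat G (finSumFinEquiv.symm p) (finSumFinEquiv.symm q)

theorem HomogMat.shift_eq {ι κ : Type*} {g₁ : ι → ℤ × ℤ} {g₂ : κ → ℤ × ℤ} {s t s' t' : ℤ}
    {M : Matrix ι κ RUV} (hM : HomogMat g₁ g₂ s t M) (hs : s = s') (ht : t = t') :
    HomogMat g₁ g₂ s' t' M := hs ▸ ht ▸ hM

theorem sumCx_dm (C₁ C₂ : PreCx) (p q : Fin (C₁.n + C₂.n)) : (sumCx C₁ C₂).dm p q =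
    Matrix.fromBlocks (Matrix.of C₁.dm) 0 0 (Matrix.of C₂.dm) (finSumFinEquiv.symm p)
      (finSumFinEquiv.symm q) := by
  obtain ⟨p, rfl⟩ := finSumFinEquiv.surjective p
  obtain ⟨q, rfl⟩ := finSumFinEquiv.surjective q
  rcases p with p | p <;> rcases q with q | q <;> simp [sumCx]

/-- A complex `S` which is a retract of `C` splits off from `C` up to homotopy; the complement is
the mapping cone of the inclusion of `S`. -/
theorem exists_splitting_of_retract {C S : PreCx} {F : Matrix (Fin C.n) (Fin S.n) RUV}
    {G : Matrix (Fin S.n) (Fin C.n) RUV} (hF : HomogMat C.gr S.gr 0 0 F)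
    (hG : HomogMat S.gr C.gr 0 0 G) (hFc : Matrix.of C.dm * F = F * Matrix.of S.dm)
    (hGc : Matrix.of S.dm * G = G * Matrix.of C.dm) (hGF : G * F = 1)
    (hsq : Matrix.of C.dm * Matrix.of C.dm = 0)
    (hdm : HomogMat C.gr C.gr (-1) (-1) (Matrix.of C.dm)) :
    ∃ A : PreCx, IsCplx A ∧ HomotopyEquivCx C (sumCx S A) := by
  have hself : ∀ {a b : ℕ} (M : Matrix (Fin a) (Fin b) RUV), M + M = 0 := fun M => by
    ext; exact RUV_add_self _
  have hS : Matrix.of S.dm = G * Matrix.of C.dm * F := by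
    rw [← hGc, Matrix.mul_assoc, hGF, Matrix.mul_one]
  have hSsq : Matrix.of S.dm * Matrix.of S.dm = 0 := by
    nth_rewrite 2 [hS]
    rw [Matrix.mul_assoc, ← Matrix.mul_assoc, hGc, ← Matrix.mul_assoc, Matrix.mul_assoc G,
      hsq, Matrix.mul_zero, Matrix.zero_mul]
  have hSdm : HomogMat S.gr S.gr (-1) (-1) (Matrix.of S.dm) := by
    rw [hS]
    exact ((hG.mul hdm).mul hF).shift_eq (by norm_num) (by norm_num)
  refine ⟨coneCx G, ⟨fun x => ?_, fun i j => ?_⟩, ?_⟩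
  · have hz : coneMat G * coneMat G = 0 := by
      have hcancel : G * Matrix.of C.dm + Matrix.of S.dm * G = 0 := by
        rw [hGc, hself]
      rw [coneMat, Matrix.fromBlocks_multiply]
      simp only [hsq, hSsq, hcancel, Matrix.zero_mul, Matrix.mul_zero, add_zero,
        Matrix.fromBlocks_zero]
    have hz' : Matrix.of (coneCx G).dm * Matrix.of (coneCx G).dm = 0 :=
      (Matrix.submatrix_mul_equiv (coneMat G) (coneMat G) finSumFinEquiv.symm
        finSumFinEquiv.symm finSumFinEquiv.symm).trans (by rw [hz]; rfl)
    rw [dmap_eq_matMap, ← matMap_mul, hz', matMap_zero]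
  · have h : HomogMat (coneGr C S) (coneGr C S) (-1) (-1) (coneMat G) := by
      rintro (i | i) (j | j)
      · exact hdm i j
      · exact isHomog_zero _ _
      · simpa [coneGr, coneMat] using hG i j
      · convert! hSdm i j using 1 <;> simp [coneGr] <;> ring
    exact h (finSumFinEquiv.symm i) (finSumFinEquiv.symm j)
  let e : Fin (sumCx S (coneCx G)).n ≃ Fin S.n ⊕ (Fin C.n ⊕ Fin S.n) :=
    finSumFinEquiv.symm.trans (Equiv.sumCongr (Equiv.refl _) finSumFinEquiv.symm)
  have hid : HomogMat C.gr C.gr 0 0 (1 + F * G) :=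
    homogMat_one.add ((hF.mul hG).shift_eq (by norm_num) (by norm_num))
  have hGid : G * (1 + F * G) = 0 := by
    rw [Matrix.mul_add, Matrix.mul_one, ← Matrix.mul_assoc, hGF, Matrix.one_mul, hself]
  have hidF : (1 + F * G) * F = 0 := by
    rw [Matrix.add_mul, Matrix.one_mul, Matrix.mul_assoc, hGF, Matrix.mul_one, hself]
  have hidid : (1 + F * G) * (1 + F * G) = 1 + F * G := by
    nth_rewrite 1 [Matrix.add_mul]
    rw [Matrix.one_mul, Matrix.mul_assoc, hGid, Matrix.mul_zero, add_zero]
  have hidc : Matrix.of C.dm * (1 + F * G) = (1 + F * G) * Matrix.of C.dm := by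
    rw [Matrix.mul_add, Matrix.add_mul, Matrix.mul_one, Matrix.one_mul, ← Matrix.mul_assoc, hFc,
      Matrix.mul_assoc, hGc, Matrix.mul_assoc]
  refine homotopyEquivCx_of_matrix e (g := Sum.elim S.gr (coneGr C S))
    (D := Matrix.fromBlocks (Matrix.of S.dm) 0 0 (coneMat G))
    (Φ := Matrix.fromCols F (Matrix.fromCols (1 + F * G) 0))
    (Ψ := Matrix.fromRows G (Matrix.fromRows (1 + F * G) 0))
    (H := Matrix.fromBlocks 0 0 0 (Matrix.fromBlocks 0 F 0 0))
    (fun p => ?_) ?_ ?_ ?_ ?_ ?_ ?_ ?_ ?_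
  · change Sum.elim S.gr (coneCx G).gr (finSumFinEquiv.symm p) =
      Sum.elim S.gr (coneGr C S) (Sum.map id finSumFinEquiv.symm (finSumFinEquiv.symm p))
    suffices h : ∀ p' : Fin S.n ⊕ Fin (coneCx G).n, Sum.elim S.gr (coneCx G).gr p' =
        Sum.elim S.gr (coneGr C S) (Sum.map id finSumFinEquiv.symm p') from h _
    rintro (p' | p') <;> rfl
  · have h : ∀ p' q' : Fin S.n ⊕ Fin (coneCx G).n,
        Matrix.fromBlocks (Matrix.of S.dm) 0 0 (Matrix.of (coneCx G).dm) p' q' =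
        Matrix.fromBlocks (Matrix.of S.dm) 0 0 (coneMat G) (Sum.map id finSumFinEquiv.symm p')
          (Sum.map id finSumFinEquiv.symm q') := by
      rintro (p' | p') (q' | q') <;> rfl
    ext p q
    exact (sumCx_dm S (coneCx G) p q).trans (h _ _)
  · rintro i (j | j | j)
    · exact hF i j
    · exact hid i j
    · exact isHomog_zero _ _
  · rintro (i | i | i) j
    · exact hG i j
    · exact hid i j
    · exact isHomog_zero _ _
  · rintro (i | i | i) (j | j | j)
    iterate 5 exact isHomog_zero _ _
    · simpa [coneGr] using hF i j
    iterate 3 exact isHomog_zero _ _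
  · simp only [coneMat, Matrix.mul_fromCols, Matrix.fromCols_mul_fromBlocks, hFc, hidc,
      Matrix.mul_zero, add_zero, zero_add, Matrix.zero_mul]
  · simp only [coneMat, Matrix.fromRows_mul, Matrix.fromBlocks_mul_fromRows, hGc, hidc, hGid,
      Matrix.mul_zero, add_zero, zero_add, Matrix.zero_mul]
  · rw [Matrix.fromCols_mul_fromRows, Matrix.fromCols_mul_fromRows, hidid, Matrix.mul_zero,
      add_zero, add_left_comm, hself, add_zero]
  · have hone : 1 + F * G + 1 = F * G := by
      rw [add_right_comm, hself, zero_add]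
    have hprod : Matrix.fromRows G (Matrix.fromRows (1 + F * G) (0 : Matrix (Fin S.n) _ _)) *
        Matrix.fromCols F (Matrix.fromCols (1 + F * G) (0 : Matrix _ (Fin S.n) _)) =
        Matrix.fromBlocks 1 0 0 (Matrix.fromBlocks (1 + F * G) 0 0 0) := by
      rw [Matrix.fromRows_mul_fromCols, Matrix.fromRows_mul_fromCols, Matrix.mul_fromCols,
        Matrix.fromRows_mul, hGF, hGid, hidF, hidid]
      simp
    rw [hprod, ← Matrix.fromBlocks_one, ← Matrix.fromBlocks_one]
    simp only [coneMat, Matrix.fromBlocks_multiply, Matrix.fromBlocks_add, hGF, hFc, hself, hone,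
      Matrix.zero_mul, Matrix.mul_zero, add_zero, zero_add]

/-! ### Tower generators of standard complexes and the degrees of local maps -/

theorem mem_uSub_of_forall_dvd {C : PreCx} {x : Msub C} (h : ∀ j, Uv ∣ x j) : x ∈ uSub C := by
  choose y hy using h
  exact ⟨Finsupp.equivFunOnFinite.symm y, by ext j; simpa using (hy j).symm⟩

theorem mem_vSub_of_forall_dvd {C : PreCx} {x : Msub C} (h : ∀ j, Vv ∣ x j) : x ∈ vSub C := by
  choose y hy using h
  exact ⟨Finsupp.equivFunOnFinite.symm y, by ext j; simpa using (hy j).symm⟩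

theorem towerHom_one_apply_of_mem_uSub {C : PreCx} {x : Msub C} (h : x ∈ uSub C) (j : Fin C.n) :
    towerHom 1 (x j) = 0 := by
  obtain ⟨y, rfl⟩ := h
  simp [towerHom_Uv]

theorem dmap_single_mem_uSub {C : PreCx} {i : Fin C.n} (h : ∀ j, Uv ∣ C.dm i j) :
    dmap C (Finsupp.single i 1) ∈ uSub C := by
  refine mem_uSub_of_forall_dvd fun j => ?_
  rw [dmap_eq_matMap, matMap_single_apply]
  exact h j

theorem dmap_single_mem_vSub {C : PreCx} {i : Fin C.n} (h : ∀ j, Vv ∣ C.dm i j) :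
    dmap C (Finsupp.single i 1) ∈ vSub C := by
  refine mem_vSub_of_forall_dvd fun j => ?_
  rw [dmap_eq_matMap, matMap_single_apply]
  exact h j

theorem towerHom_dmap_apply {C : PreCx} {c : ℕ} {j : Fin C.n}
    (h : ∀ i, towerHom c (C.dm i j) = 0) (x : Msub C) : towerHom c (dmap C x j) = 0 := by
  rw [dmap_eq_matMap, matMap_apply, map_sum]
  refine Finset.sum_eq_zero fun i _ => ?_
  rw [map_mul]
  exact mul_eq_zero_of_right _ (h i)

/-- If the basis element `i` is a cycle mod `U` which is not hit by any `V`-arrow, then every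
`V`-tower generator has nonvanishing constant term on it. -/
theorem IsVTowerGen.coeff_ne_zero {C : PreCx} {w : Msub C} (hw : IsVTowerGen C w) {i : Fin C.n}
    (hrow : ∀ j, Uv ∣ C.dm i j) (hcol : ∀ j, towerHom 1 (C.dm j i) = 0) :
    (towerHom 1 (w i)).coeff 0 ≠ 0 := by
  obtain ⟨r, k, hk⟩ := hw.2.2 _ (dmap_single_mem_uSub hrow)
  obtain ⟨u, hu, _, ⟨v, rfl⟩, huv⟩ := Submodule.mem_sup.mp hk
  have h := congrArg (towerHom 1) (DFunLike.congr_fun huv i)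
  have h' : (X : (ZMod 2)[X]) ^ k * (1 - towerHom 1 r * towerHom 1 (w i)) = 0 := by
    rw [Finsupp.add_apply, map_add, towerHom_one_apply_of_mem_uSub hu,
      towerHom_dmap_apply hcol] at h
    simpa [towerHom_Vv] using h.symm
  have h1 := (mul_eq_zero.mp h').resolve_left (pow_ne_zero _ X_ne_zero)
  intro hz
  simpa [mul_coeff_zero, hz] using congrArg (fun p : (ZMod 2)[X] => p.coeff 0) h1

/-- Let `g : S → C` be a chain map into a knot-like complex which has a left inverse chain map.
If `S` has a basis element of `V`-grading `0` which is a cycle mod `V` and is not hit by any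
`U`-arrow, then `g` is absolutely `V`-graded. -/
theorem snd_shift_eq_zero_of_retract {C S : PreCx} (hC : IsKnotLike C) {n : Fin S.n}
    (hn : (S.gr n).2 = 0) (hrow : ∀ j, Vv ∣ S.dm n j) (hcol : ∀ j, towerHom 0 (S.dm j n) = 0)
    {g : Msub S →ₗ[RUV] Msub C} {f : Msub C →ₗ[RUV] Msub S} {s : ℤ}
    (hg : MapHomogShift S C g 0 s) (hgc : ∀ x, g (dmap S x) = dmap C (g x))
    (hfc : ∀ x, f (dmap C x) = dmap S (f x)) (hfg : ∀ x, f (g x) = x) : s = 0 := by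
  refine hC.uTowerGr (g (Finsupp.single n 1)) (S.gr n).1 s (fun j => ?_) ?_ fun k hk => ?_
  · have h := hg n j
    rwa [hn, zero_add, add_zero] at h
  · rw [← hgc]
    obtain ⟨y, hy⟩ := dmap_single_mem_vSub hrow
    refine ⟨g y, ?_⟩
    rw [← hy]
    exact (g.map_smul Vv y).symm
  · obtain ⟨_, ⟨u, rfl⟩, _, ⟨v, rfl⟩, huv⟩ := Submodule.mem_sup.mp hk
    have h := congrArg (towerHom 0) (DFunLike.congr_fun (congrArg f huv) n)
    rw [map_add, Finsupp.add_apply, hfc, map_add, towerHom_dmap_apply hcol] at h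
    simp only [hfg, map_smul, LinearMap.lsmul_apply, Finsupp.smul_apply, smul_eq_mul, map_mul,
      towerHom_Vv, zero_ne_one, if_false, zero_mul, add_zero, map_pow, towerHom_Uv, if_true,
      Finsupp.single_eq_same, mul_one] at h
    exact pow_ne_zero k X_ne_zero h.symm

section Tower

variable {L : List ℤ}

theorem Uv_dvd_stdDm_zero (L : List ℤ) (j : Fin (L.length + 1)) : Uv ∣ stdDm L 0 j := by
  unfold stdDm
  rw [Fin.val_zero]
  split_ifs <;> first | exact dvd_pow_self _ (by omega) | exact dvd_zero _ | simp_all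

theorem Vv_dvd_stdDm_last (hL : Even L.length) (j : Fin (L.length + 1)) :
    Vv ∣ stdDm L (Fin.last L.length) j := by
  have hj := j.2
  have hl := Nat.even_iff.mp hL
  unfold stdDm
  rw [Fin.val_last]
  split_ifs <;> first | exact dvd_pow_self _ (by omega) | exact dvd_zero _ | omega

theorem towerHom_one_stdDm_zero (k : Fin (L.length + 1)) : towerHom 1 (stdDm L k 0) = 0 := by
  rw [towerHom_stdDm one_lt_two]
  split_ifs with h₁ h₂
  · simp at h₁
  · simp at h₂
  · rfl

theorem towerHom_zero_stdDm_last (hL : Even L.length) (k : Fin (L.length + 1)) :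
    towerHom 0 (stdDm L k (Fin.last L.length)) = 0 := by
  have hk := k.2
  have hl := Nat.even_iff.mp hL
  rw [towerHom_stdDm two_pos, Fin.val_last]
  split_ifs with h₁ h₂
  · omega
  · omega
  · rfl

/-- Every basis element of a standard complex other than `x_0` is the source or the target of a
`V`-arrow. -/
theorem exists_V_arrow (hL : IsStdSeq L) {i : Fin (L.length + 1)} (hi : i ≠ 0) :
    ∃ (j : Fin (L.length + 1)) (a : ℕ),
      (∀ k, towerHom 1 (stdDm L k j) = if k = i then X ^ a else 0) ∨
      (∀ k, towerHom 1 (stdDm L j k) = if k = i then X ^ a else 0) := by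
  have hlt := i.2
  have hl := Nat.even_iff.mp hL.2
  have hi0 : (i : ℕ) ≠ 0 := fun h => hi (Fin.ext h)
  have hne : ∀ k < L.length, L.getD k 0 ≠ 0 := fun k hk => by
    rw [List.getD_eq_getElem _ _ hk]
    exact hL.1 _ (List.getElem_mem hk)
  rcases Nat.mod_two_eq_zero_or_one i with hp | hp
  · let j : Fin (L.length + 1) := ⟨i - 1, by omega⟩
    have hj : (j : ℕ) = i - 1 := rfl
    have hjp : (j : ℕ) % 2 = 1 := by omega
    have hk : ∀ k : Fin (L.length + 1), (k : ℕ) = j + 1 ↔ k = i := fun k => by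
      rw [Fin.ext_iff]; omega
    refine ⟨j, (L.getD j 0).natAbs, ?_⟩
    rcases lt_or_gt_of_ne (hne j (by omega)) with hb | hb
    · right
      intro k
      rw [towerHom_stdDm_left one_lt_two hjp]
      simp only [hk, hb, and_true]
    · left
      intro k
      rw [towerHom_stdDm_right one_lt_two hjp]
      simp only [hk, hb, and_true]
  · have hb := hne i (by omega)
    obtain ⟨j, hj⟩ := exists_succ_of_getD_ne_zero hb
    refine ⟨j, (L.getD i 0).natAbs, ?_⟩
    rcases lt_or_gt_of_ne hb with hb | hb
    · left
      intro k
      rw [towerHom_stdDm_succ_right one_lt_two hp hj]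
      simp only [hb, and_true]
    · right
      intro k
      rw [towerHom_stdDm_succ_left one_lt_two hp hj]
      simp only [hb, and_true]

/-- A chain endomorphism of a standard complex which does not kill the constant term on `x_0` of
a cycle mod `U` has
nonvanishing constant term on `x_0`. -/
theorem coeff_ne_zero_of_cycle (hL : IsStdSeq L)
    {M : Matrix (Fin (L.length + 1)) (Fin (L.length + 1)) RUV}
    (hM : Matrix.of (stdDm L) * M = M * Matrix.of (stdDm L)) {w : Fin (L.length + 1) →₀ RUV}
    (hw : ∀ j, towerHom 1 (matMap (Matrix.of (stdDm L)) w j) = 0)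
    (hMw : (towerHom 1 (matMap M w 0)).coeff 0 ≠ 0) :
    (towerHom 1 (M 0 0)).coeff 0 ≠ 0 := by
  have key : ∀ i : Fin (L.length + 1), i ≠ 0 → towerHom 1 (w i) * towerHom 1 (M i 0) = 0 := by
    intro i hi
    obtain ⟨j, a, h | h⟩ := exists_V_arrow hL hi
    · have hj := hw j
      simp only [matMap_apply, Matrix.of_apply, map_sum, map_mul, h, mul_ite, mul_zero,
        Finset.sum_ite_eq', Finset.mem_univ, if_true] at hj
      rw [(mul_eq_zero.mp hj).resolve_right (pow_ne_zero _ X_ne_zero), zero_mul]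
    · have hj := congrArg (towerHom 1) (congrFun (congrFun hM j) 0)
      simp only [Matrix.mul_apply, Matrix.of_apply, map_sum, map_mul, h,
        towerHom_one_stdDm_zero, ite_mul, zero_mul, mul_zero, Finset.sum_ite_eq',
        Finset.mem_univ, if_true, Finset.sum_const_zero] at hj
      rw [(mul_eq_zero.mp hj).resolve_left (pow_ne_zero _ X_ne_zero), mul_zero]
  have h : towerHom 1 (matMap M w 0) = towerHom 1 (w 0) * towerHom 1 (M 0 0) := by
    simp only [matMap_apply, map_sum, map_mul]
    exact Finset.sum_eq_single 0 (fun i _ => key i) (by simp)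
  intro hz
  rw [h, mul_coeff_zero, hz, mul_zero] at hMw
  exact hMw rfl

theorem exists_pow_eq_one_of_isVTowerGen (hL : IsStdSeq L)
    {M : Matrix (Fin (L.length + 1)) (Fin (L.length + 1)) RUV} {t : ℤ}
    (hM : HomogMat (stdGr L) (stdGr L) 0 t M)
    (hMc : Matrix.of (stdDm L) * M = M * Matrix.of (stdDm L)) {w : Msub (StdCx L)}
    (hw : IsVTowerGen (StdCx L) w) (hMw : IsVTowerGen (StdCx L) (matMap M w)) :
    t = 0 ∧ ∃ k, M ^ (k + 1) = 1 := by
  have h0 : M 0 0 = 1 := (hM 0 0).eq_one_of_towerHom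
    (coeff_ne_zero_of_cycle hL hMc (towerHom_one_apply_of_mem_uSub hw.1)
      (hMw.coeff_ne_zero (i := (0 : Fin (L.length + 1))) (Uv_dvd_stdDm_zero L)
        towerHom_one_stdDm_zero))
  have ht : t = 0 := by
    have h := hM 0 0
    rw [h0] at h
    simpa using h.degree_of_eq_one.2
  subst ht
  exact ⟨rfl, hM.exists_pow_eq_one (towerHom_det_ne_zero hL.1 hM hMc h0)⟩

end Tower

theorem IsLocalMap.matrix_comm {C₁ C₂ : PreCx} {f : Msub C₁ →ₗ[RUV] Msub C₂}
    (hf : IsLocalMap C₁ C₂ f) :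
    Matrix.of C₁.dm * mapMat f = mapMat f * Matrix.of C₂.dm := by
  rw [← mapMat_matMap (Matrix.of C₁.dm * mapMat f), ← mapMat_matMap (mapMat f * Matrix.of C₂.dm)]
  refine congrArg mapMat (LinearMap.ext fun x => ?_)
  rw [matMap_mul, matMap_mul, matMap_mapMat]
  exact hf.chain x

/-- If every local self-map of `S` has bidegree `(0, 0)` and finite order, and `S` has a
`U`-tower basis element of `V`-grading `0`, then `S` splits off from every knot-like complex
locally equivalent to it. -/
theorem LocalEquiv.exists_splitting {C S : PreCx} (h : LocalEquiv C S) (hC : IsKnotLike C)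
    (hS : ∀ (t : ℤ) (M : Matrix (Fin S.n) (Fin S.n) RUV) (w : Msub S),
      HomogMat S.gr S.gr 0 t M → Matrix.of S.dm * M = M * Matrix.of S.dm →
      IsVTowerGen S w → IsVTowerGen S (matMap M w) → t = 0 ∧ ∃ k, M ^ (k + 1) = 1)
    {n : Fin S.n} (hn : (S.gr n).2 = 0) (hrow : ∀ j, Vv ∣ S.dm n j)
    (hcol : ∀ j, towerHom 0 (S.dm j n) = 0) :
    ∃ A : PreCx, IsCplx A ∧ HomotopyEquivCx C (sumCx S A) := by
  obtain ⟨⟨f, hf⟩, g, hg⟩ := h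
  obtain ⟨s, hs⟩ := hf.graded
  obtain ⟨t, ht⟩ := hg.graded
  obtain ⟨y, hy⟩ := hC.vTowerExists
  have hF : HomogMat C.gr S.gr 0 s (mapMat f) := hs
  have hG : HomogMat S.gr C.gr 0 t (mapMat g) := ht
  have hFc := hf.matrix_comm
  have hGc := hg.matrix_comm
  set M := mapMat g * mapMat f with hMdef
  have hM : HomogMat S.gr S.gr 0 (t + s) M := hG.mul hF
  have hMc : Matrix.of S.dm * M = M * Matrix.of S.dm := by
    rw [hMdef, ← Matrix.mul_assoc, hGc, Matrix.mul_assoc, hFc, Matrix.mul_assoc]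
  have hMw : matMap M (f y) = f (g (f y)) := by
    rw [hMdef, matMap_mul, matMap_mapMat, matMap_mapMat]
  have hw := hf.towers y hy
  obtain ⟨hst, k, hk⟩ := hS _ M (f y) hM hMc hw (hMw ▸ hf.towers _ (hg.towers _ hw))
  rw [hst] at hM
  have hcomm : Matrix.of S.dm * M ^ k = M ^ k * Matrix.of S.dm :=
    (Commute.pow_right (show Commute (Matrix.of S.dm) M from hMc) k).eq
  set F := mapMat f * M ^ k with hFdef
  have hF' : HomogMat C.gr S.gr 0 s F :=
    (hF.mul (hM.pow k)).shift_eq (add_zero 0) (add_zero s)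
  have hFc' : Matrix.of C.dm * F = F * Matrix.of S.dm := by
    rw [hFdef, ← Matrix.mul_assoc, hFc, Matrix.mul_assoc, hcomm, Matrix.mul_assoc]
  have hGF : mapMat g * F = 1 := by
    rw [hFdef, ← Matrix.mul_assoc, ← hMdef, ← pow_succ', hk]
  have ht0 : t = 0 := by
    refine snd_shift_eq_zero_of_retract hC hn hrow hcol ht hg.chain (f := matMap F)
      (fun x => ?_) fun x => ?_
    · rw [dmap_eq_matMap, dmap_eq_matMap, ← matMap_mul, hFc', matMap_mul]
    · conv_lhs => rw [← matMap_mapMat g]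
      rw [← matMap_mul, hGF, matMap_one]
  have hs0 : s = 0 := by omega
  subst ht0 hs0
  refine exists_splitting_of_retract hF' hG hFc' hGc hGF ?_ fun i j => ?_
  · rw [← mapMat_matMap (Matrix.of C.dm * Matrix.of C.dm)]
    ext i j
    change matMap (Matrix.of C.dm * Matrix.of C.dm) (Finsupp.single i 1) j = 0
    rw [matMap_mul, ← dmap_eq_matMap, hC.dsq, Finsupp.zero_apply]
  · exact hC.dhomog i j

end SplitOff

/-- Let `C` be a knot-like complex which is locally equivalent to the
standard complex `C(a_1, …, a_n)`.  Then `C` is homotopy equivalent, as a bigraded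
chain complex over `R`, to `C(a_1, …, a_n) ⊕ A` for some chain complex `A` over `R`. -/
theorem splits_off_standard_summand (C : PreCx) (hC : IsKnotLike C)
    (L : List ℤ) (hL : IsStdSeq L) (h : LocalEquiv C (StdCx L)) :
    ∃ A : PreCx, IsCplx A ∧ HomotopyEquivCx C (sumCx (StdCx L) A) := by
  exact h.exists_splitting hC
    (fun _ _ _ hM hMc hw hMw => exists_pow_eq_one_of_isVTowerGen hL hM hMc hw hMw)
    (n := Fin.last L.length) (sub_self _) (Vv_dvd_stdDm_last hL.2)
    (towerHom_zero_stdDm_last hL.2)
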